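/- arXiv:1907.07624 — 2 statements merged into one kernel-verified Lean document; each statement's English description precedes it below -/
import Mathlib

section
/- Let n, m be integers with 1 ≤ n and 2n ≤ m, and let P ∈ ℂ[t] be a monic polynomial of degree m. Then the assignment (a,b,c,d) ↦ (p_a, r_b, s_c, q_d) restricts to a bijection from the set {(a,b,c,d) ∈ ℂⁿ×ℂⁿ×ℂⁿ×ℂ^{m−n} : det(t·1ₘ − M(a,b,c,d)) = P} onto the set of quadruples (p, r, s, q) of polynomials in ℂ[t] such that p is monic of degree n, q is monic of degree m−n, r and s have degree at most n−1 (or are zero), and p·q − r·s = P. (This identifies the fibre of the adjoint quotient map over P on the two-Jordan-block slice with the space of such polynomial quadruples.) -/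
/-- `p_a(t) = tᵏ − Σ_{i=1}^{k} a_i t^{k−i}` (for a 1-based family `a`, here indexed by
`Fin k`, so that `a ⟨i-1⟩ = a_i`). -/
noncomputable def charSlicePoly (k : ℕ) (a : Fin k → ℂ) : Polynomial ℂ :=
  Polynomial.X ^ k - ∑ i : Fin k, Polynomial.C (a i) * Polynomial.X ^ (k - 1 - i.val)

/-- `r_b(t) = Σ_{i=1}^{k} b_i t^{k−i}`. -/
noncomputable def lowSlicePoly (k : ℕ) (b : Fin k → ℂ) : Polynomial ℂ :=
  ∑ i : Fin k, Polynomial.C (b i) * Polynomial.X ^ (k - 1 - i.val)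

/-- The Slodowy-slice matrix `M(a,b,c,d)`: the `m × m` complex matrix (with rows and columns
indexed by `Fin m`, where the index `i : Fin m` corresponds to the 1-based index `i.val + 1`)
whose only nonzero entries are `M_{i,1} = a_i` for `1 ≤ i ≤ n`, `M_{m−n+i,1} = c_i` for
`1 ≤ i ≤ n`, `M_{i,n+1} = b_i` for `1 ≤ i ≤ n`, `M_{n+i,n+1} = d_i` for `1 ≤ i ≤ m−n`, and
`M_{i,i+1} = 1` for `1 ≤ i ≤ n−1` and for `n+1 ≤ i ≤ m−1`. -/
def slodowyMatrix (n m : ℕ) (a b c : Fin n → ℂ) (d : Fin (m - n) → ℂ) :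
    Matrix (Fin m) (Fin m) ℂ := fun i j =>
  if j.val = 0 then
    if h : i.val < n then a ⟨i.val, h⟩
    else if h2 : m - n ≤ i.val ∧ i.val - (m - n) < n then c ⟨i.val - (m - n), h2.2⟩
    else 0
  else if j.val = n then
    if h : i.val < n then b ⟨i.val, h⟩
    else if h2 : i.val - n < m - n then d ⟨i.val - n, h2⟩
    else 0
  else if j.val = i.val + 1 then 1 else 0

open Polynomial in
theorem coeff_lowSlicePoly (k : ℕ) (b : Fin k → ℂ) (i : Fin k) :
    (lowSlicePoly k b).coeff (k - 1 - i.val) = b i := by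
  simp only [lowSlicePoly, finsetSum_coeff, coeff_C_mul_X_pow]
  rw [Finset.sum_eq_single i]
  · simp
  · intro j _ hj
    rw [if_neg]
    intro h
    apply hj
    ext
    omega
  · simp

theorem lowSlicePoly_injective (k : ℕ) : Function.Injective (lowSlicePoly k) := fun b b' h => by
  ext i
  rw [← coeff_lowSlicePoly k b i, h, coeff_lowSlicePoly]

open Polynomial in
theorem degree_lowSlicePoly_lt (k : ℕ) (b : Fin k → ℂ) :
    (lowSlicePoly k b).degree < (k : WithBot ℕ) := by
  refine (degree_sum_le _ _).trans_lt ((Finset.sup_lt_iff (WithBot.bot_lt_coe k)).2 fun i _ => ?_)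
  refine (degree_C_mul_X_pow_le _ _).trans_lt ?_
  have := i.isLt
  exact WithBot.coe_lt_coe.2 (by simp only [Nat.cast_id]; omega)

open Polynomial in
theorem lowSlicePoly_coeff_eq {k : ℕ} {r : ℂ[X]} (hr : r.degree < (k : WithBot ℕ)) :
    lowSlicePoly k (fun i => r.coeff (k - 1 - i.val)) = r := by
  ext j
  by_cases hj : j < k
  · have h := coeff_lowSlicePoly k (fun i => r.coeff (k - 1 - i.val)) ⟨k - 1 - j, by omega⟩
    have hjj : k - 1 - (k - 1 - j) = j := by omega
    simpa only [hjj] using h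
  · have hkj : (k : WithBot ℕ) ≤ (j : WithBot ℕ) := by exact_mod_cast not_lt.1 hj
    rw [coeff_eq_zero_of_degree_lt ((degree_lowSlicePoly_lt k _).trans_le hkj),
      coeff_eq_zero_of_degree_lt (hr.trans_le hkj)]

open Polynomial in
theorem charSlicePoly_eq (k : ℕ) (a : Fin k → ℂ) :
    charSlicePoly k a = X ^ k - lowSlicePoly k a := rfl

theorem charSlicePoly_injective (k : ℕ) : Function.Injective (charSlicePoly k) := fun _ _ h =>
  lowSlicePoly_injective k (sub_right_injective h)

theorem monic_charSlicePoly (k : ℕ) (a : Fin k → ℂ) : (charSlicePoly k a).Monic :=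
  Polynomial.monic_X_pow_sub (degree_lowSlicePoly_lt k a)

open Polynomial in
theorem natDegree_charSlicePoly (k : ℕ) (a : Fin k → ℂ) : (charSlicePoly k a).natDegree = k := by
  apply natDegree_eq_of_degree_eq_some
  rw [charSlicePoly_eq, degree_sub_eq_left_of_degree_lt, degree_X_pow]
  rw [degree_X_pow]
  exact degree_lowSlicePoly_lt k a

open Polynomial in
theorem exists_charSlicePoly_eq {k : ℕ} {p : ℂ[X]} (hp : p.Monic) (hk : p.natDegree = k) :
    ∃ a, charSlicePoly k a = p := by
  have hdeg : p.degree = k := by rw [degree_eq_natDegree hp.ne_zero, hk]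
  have h : (X ^ k - p).degree < (k : WithBot ℕ) := by
    rw [← degree_X_pow (R := ℂ) k]
    apply degree_sub_lt_left
    · rw [degree_X_pow, hdeg]
    · exact (monic_X_pow k).ne_zero
    · rw [(monic_X_pow k).leadingCoeff, hp.leadingCoeff]
  exact ⟨_, by rw [charSlicePoly_eq, lowSlicePoly_coeff_eq h, sub_sub_cancel]⟩

/-- The matrix `t·1 - N`, where `N` is the nilpotent matrix with two Jordan blocks, of sizes
`n` and `m - n`. -/
def twoJordanBlocks (n m : ℕ) (t : ℂ) : Matrix (Fin m) (Fin m) ℂ := fun i j =>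
  (if i = j then t else 0) - if j.val = i.val + 1 ∧ j.val ≠ n then 1 else 0

theorem det_twoJordanBlocks (n m : ℕ) (t : ℂ) : (twoJordanBlocks n m t).det = t ^ m := by
  rw [Matrix.det_of_isUpperTriangular]
  · simp [twoJordanBlocks]
  · intro i j hij
    have h : j.val < i.val := hij
    have h1 : i ≠ j := fun h' => by simp [h'] at h
    have h2 : ¬ (j.val = i.val + 1 ∧ j.val ≠ n) := by omega
    simp [twoJordanBlocks, h1, h2]

/-- The rows `0` and `n` of the inverse of `twoJordanBlocks n m t`. -/
noncomputable def headRows (n m : ℕ) (t : ℂ) : Matrix (Fin 2) (Fin m) ℂ :=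
  Matrix.of ![fun j => if j.val < n then t⁻¹ ^ (j.val + 1) else 0,
    fun j => if n ≤ j.val then t⁻¹ ^ (j.val - n + 1) else 0]

theorem sum_mul_twoJordanBlocks (n m : ℕ) (t : ℂ) (f : ℕ → ℂ) (j : Fin m) :
    ∑ k : Fin m, f k.val * twoJordanBlocks n m t k j =
      f j.val * t - if j.val = 0 ∨ j.val = n then 0 else f (j.val - 1) := by
  simp only [twoJordanBlocks, mul_sub, Finset.sum_sub_distrib]
  congr 1
  · simp
  · split_ifs with h
    · refine Finset.sum_eq_zero fun k _ => ?_
      rw [if_neg (by omega), mul_zero]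
    · rw [Finset.sum_eq_single ⟨j.val - 1, by omega⟩]
      · rw [if_pos (by simp only; omega), mul_one]
      · intro k _ hk
        rw [if_neg, mul_zero]
        intro h'
        apply hk
        ext
        simp only
        omega
      · simp

theorem headRows_mul_twoJordanBlocks (n m : ℕ) (hn : 1 ≤ n) {t : ℂ} (ht : t ≠ 0) :
    headRows n m t * twoJordanBlocks n m t =
      Matrix.of ![fun j => if j.val = 0 then 1 else 0, fun j => if j.val = n then 1 else 0] := by
  ext r j
  rw [Matrix.mul_apply]
  fin_cases r
  · refine (sum_mul_twoJordanBlocks n m t (fun k => if k < n then t⁻¹ ^ (k + 1) else 0) j).trans ?_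
    obtain ⟨j, hj⟩ := j
    rcases j with _ | j
    · simp [ht, show 0 < n from hn]
    · simp only [Fin.zero_eta, Matrix.of_apply, Matrix.cons_val_zero]
      split_ifs <;> first | omega | simp_all [pow_succ]
  · refine (sum_mul_twoJordanBlocks n m t
      (fun k => if n ≤ k then t⁻¹ ^ (k - n + 1) else 0) j).trans ?_
    obtain ⟨j, hj⟩ := j
    simp only [Fin.mk_one, Matrix.of_apply, Matrix.cons_val_one, Matrix.cons_val_zero]
    rcases lt_trichotomy j n with h | rfl | h
    · rw [if_neg h.ne]
      split_ifs <;> first | omega | simp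
    · simp [ht]
    · obtain ⟨e, rfl⟩ := Nat.exists_eq_add_of_lt h
      have e1 : n + e + 1 - n + 1 = e + 1 + 1 := by omega
      have e2 : n + e + 1 - 1 - n + 1 = e + 1 := by omega
      simp only [e1, e2]
      rw [if_pos h.le, if_neg (by omega), if_pos (by omega), if_neg h.ne']
      simp [pow_succ, ht]

/-- The columns `0` and `n` of the Slodowy-slice matrix. -/
def slodowyColumns (n m : ℕ) (a b c : Fin n → ℂ) (d : Fin (m - n) → ℂ) :
    Matrix (Fin m) (Fin 2) ℂ := Matrix.of fun i => ![
    if h : i.val < n then a ⟨i.val, h⟩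
    else if h2 : m - n ≤ i.val ∧ i.val - (m - n) < n then c ⟨i.val - (m - n), h2.2⟩
    else 0,
    if h : i.val < n then b ⟨i.val, h⟩
    else if h2 : i.val - n < m - n then d ⟨i.val - n, h2⟩
    else 0]

theorem sub_slodowyMatrix_eq (n m : ℕ) (hn : 1 ≤ n) (a b c : Fin n → ℂ) (d : Fin (m - n) → ℂ)
    {t : ℂ} (ht : t ≠ 0) :
    Matrix.scalar (Fin m) t - slodowyMatrix n m a b c d =
      (1 - slodowyColumns n m a b c d * headRows n m t) * twoJordanBlocks n m t := by
  rw [sub_mul, one_mul, Matrix.mul_assoc, headRows_mul_twoJordanBlocks n m hn ht]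
  ext i j
  simp only [Matrix.sub_apply, Matrix.mul_apply, Fin.sum_univ_two, Matrix.scalar_apply,
    Matrix.diagonal_apply, twoJordanBlocks, slodowyMatrix, slodowyColumns, Matrix.cons_val_zero,
    Matrix.cons_val_one, Matrix.of_apply]
  rw [sub_sub]
  congr 1
  by_cases h0 : j.val = 0
  · have h1 : ¬ (0 = n) := by omega
    simp [h0, h1]
  · by_cases h1 : j.val = n
    · simp [h1, show n ≠ 0 by omega]
    · simp [h0, h1]

theorem pow_mul_inv_pow_of_add_eq {t : ℂ} (ht : t ≠ 0) {u v w : ℕ} (h : u = v + w) :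
    t ^ u * t⁻¹ ^ v = t ^ w := by
  rw [h, pow_add, inv_pow]
  field_simp

theorem pow_mul_headRows_mul_slodowyColumns (n m : ℕ) (hm : 2 * n ≤ m)
    (a b c : Fin n → ℂ) (d : Fin (m - n) → ℂ) {t : ℂ} (ht : t ≠ 0) :
    t ^ n * (headRows n m t * slodowyColumns n m a b c d) 0 0 = (lowSlicePoly n a).eval t ∧
    t ^ n * (headRows n m t * slodowyColumns n m a b c d) 0 1 = (lowSlicePoly n b).eval t ∧
    t ^ (m - n) * (headRows n m t * slodowyColumns n m a b c d) 1 0 =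
      (lowSlicePoly n c).eval t ∧
    t ^ (m - n) * (headRows n m t * slodowyColumns n m a b c d) 1 1 =
      (lowSlicePoly (m - n) d).eval t := by
  simp only [Matrix.mul_apply, Finset.mul_sum, lowSlicePoly, Polynomial.eval_finsetSum,
    Polynomial.eval_mul, Polynomial.eval_C, Polynomial.eval_pow, Polynomial.eval_X,
    headRows, slodowyColumns, Matrix.cons_val_zero, Matrix.cons_val_one, Matrix.of_apply]
  refine ⟨?_, ?_, ?_, ?_⟩ <;> symm
  · apply Fintype.sum_of_injective (fun i : Fin n => (⟨i.val, by omega⟩ : Fin m))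
    · intro i j h
      simpa [Fin.ext_iff] using h
    · intro k hk
      rw [if_neg, zero_mul, mul_zero]
      exact fun h => hk ⟨⟨k.val, h⟩, rfl⟩
    · intro i
      simp only [i.isLt, if_true, dif_pos]
      rw [← mul_assoc, pow_mul_inv_pow_of_add_eq ht (w := n - 1 - i.val) (by omega), mul_comm]
  · apply Fintype.sum_of_injective (fun i : Fin n => (⟨i.val, by omega⟩ : Fin m))
    · intro i j h
      simpa [Fin.ext_iff] using h
    · intro k hk
      rw [if_neg, zero_mul, mul_zero]
      exact fun h => hk ⟨⟨k.val, h⟩, rfl⟩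
    · intro i
      simp only [i.isLt, if_true, dif_pos]
      rw [← mul_assoc, pow_mul_inv_pow_of_add_eq ht (w := n - 1 - i.val) (by omega), mul_comm]
  · apply Fintype.sum_of_injective (fun i : Fin n => (⟨m - n + i.val, by omega⟩ : Fin m))
    · intro i j h
      simpa [Fin.ext_iff] using h
    · intro k hk
      by_cases h : n ≤ k.val
      · rw [dif_neg (by omega), dif_neg, mul_zero, mul_zero]
        refine fun h' => hk ⟨⟨k.val - (m - n), h'.2⟩, ?_⟩
        ext
        simp only
        omega
      · rw [if_neg h, zero_mul, mul_zero]
    · intro i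
      have hi := i.isLt
      have e : m - n + i.val - (m - n) = i.val := by omega
      rw [if_pos (by simp only; omega), dif_neg (by simp only; omega),
        dif_pos (by simp only; omega)]
      simp only [e]
      rw [← mul_assoc, pow_mul_inv_pow_of_add_eq ht (w := n - 1 - i.val) (by omega), mul_comm]
  · apply Fintype.sum_of_injective (fun i : Fin (m - n) => (⟨n + i.val, by omega⟩ : Fin m))
    · intro i j h
      simpa [Fin.ext_iff] using h
    · intro k hk
      rw [if_neg, zero_mul, mul_zero]
      refine fun h => hk ⟨⟨k.val - n, by omega⟩, ?_⟩
      ext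
      simp only
      omega
    · intro i
      have hi := i.isLt
      have e : n + i.val - n = i.val := by omega
      rw [if_pos (by simp only; omega), dif_neg (by simp only; omega),
        dif_pos (by simp only; omega)]
      simp only [e]
      rw [← mul_assoc, pow_mul_inv_pow_of_add_eq ht (w := m - n - 1 - i.val) (by omega), mul_comm]

theorem charpoly_slodowyMatrix (n m : ℕ) (hn : 1 ≤ n) (hm : 2 * n ≤ m)
    (a b c : Fin n → ℂ) (d : Fin (m - n) → ℂ) :
    (slodowyMatrix n m a b c d).charpoly =
      charSlicePoly n a * charSlicePoly (m - n) d - lowSlicePoly n b * lowSlicePoly n c := by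
  refine Polynomial.eq_of_infinite_eval_eq _ _
    ((Set.finite_singleton (0 : ℂ)).infinite_compl.mono fun t ht => ?_)
  replace ht : t ≠ 0 := ht
  obtain ⟨ha, hb, hc, hd⟩ := pow_mul_headRows_mul_slodowyColumns n m hm a b c d ht
  have hpow : t ^ m = t ^ n * t ^ (m - n) := by
    rw [← pow_add]
    congr 1
    omega
  simp only [Set.mem_ofPred_eq]
  rw [Matrix.eval_charpoly, sub_slodowyMatrix_eq n m hn a b c d ht, Matrix.det_mul,
    det_twoJordanBlocks, Matrix.det_one_sub_mul_comm, Matrix.det_fin_two, hpow]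
  simp only [charSlicePoly_eq, Polynomial.eval_sub, Polynomial.eval_mul, Polynomial.eval_pow,
    Polynomial.eval_X, ← ha, ← hb, ← hc, ← hd, Matrix.sub_apply, Matrix.one_apply_eq,
    Matrix.one_apply_ne (zero_ne_one : (0 : Fin 2) ≠ 1),
    Matrix.one_apply_ne (one_ne_zero : (1 : Fin 2) ≠ 0)]
  ring

/-- For `1 ≤ n`, `2n ≤ m` and a monic `P ∈ ℂ[t]` of degree `m`, the map
`(a,b,c,d) ↦ (p_a, r_b, s_c, q_d)` is a bijection from
`{(a,b,c,d) : det(t·1ₘ − M(a,b,c,d)) = P}` onto the set of quadruples `(p, r, s, q)` with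
`p` monic of degree `n`, `q` monic of degree `m − n`, `r, s` of degree at most `n − 1`
(or zero), and `p·q − r·s = P`. -/
theorem statement4 (n m : ℕ) (hn : 1 ≤ n) (hm : 2 * n ≤ m)
    (P : Polynomial ℂ) (hP : P.Monic) (hPdeg : P.natDegree = m) :
    Set.BijOn
      (fun x : (Fin n → ℂ) × (Fin n → ℂ) × (Fin n → ℂ) × (Fin (m - n) → ℂ) =>
        (charSlicePoly n x.1, lowSlicePoly n x.2.1, lowSlicePoly n x.2.2.1,
          charSlicePoly (m - n) x.2.2.2))
      {x | (slodowyMatrix n m x.1 x.2.1 x.2.2.1 x.2.2.2).charpoly = P}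
      {y : Polynomial ℂ × Polynomial ℂ × Polynomial ℂ × Polynomial ℂ |
        y.1.Monic ∧ y.1.natDegree = n ∧
        y.2.2.2.Monic ∧ y.2.2.2.natDegree = m - n ∧
        y.2.1.degree < (n : WithBot ℕ) ∧ y.2.2.1.degree < (n : WithBot ℕ) ∧
        y.1 * y.2.2.2 - y.2.1 * y.2.2.1 = P} := by
  refine ⟨?_, ?_, ?_⟩
  · rintro ⟨a, b, c, d⟩ h
    exact ⟨monic_charSlicePoly n a, natDegree_charSlicePoly n a, monic_charSlicePoly (m - n) d,
      natDegree_charSlicePoly (m - n) d, degree_lowSlicePoly_lt n b, degree_lowSlicePoly_lt n c,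
      (charpoly_slodowyMatrix n m hn hm a b c d).symm.trans h⟩
  · rintro ⟨a, b, c, d⟩ - ⟨a', b', c', d'⟩ - h
    simp only [Prod.mk.injEq] at h ⊢
    exact ⟨charSlicePoly_injective n h.1, lowSlicePoly_injective n h.2.1,
      lowSlicePoly_injective n h.2.2.1, charSlicePoly_injective (m - n) h.2.2.2⟩
  · rintro ⟨p, r, s, q⟩ ⟨hp, hpn, hq, hqn, hr, hs, h⟩
    obtain ⟨a, rfl⟩ := exists_charSlicePoly_eq hp hpn
    obtain ⟨d, rfl⟩ := exists_charSlicePoly_eq hq hqn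
    refine ⟨(a, fun i => r.coeff (n - 1 - i.val), fun i => s.coeff (n - 1 - i.val), d), ?_, ?_⟩
    · refine (charpoly_slodowyMatrix n m hn hm _ _ _ _).trans ?_
      rw [lowSlicePoly_coeff_eq hr, lowSlicePoly_coeff_eq hs]
      exact h
    · simp only [lowSlicePoly_coeff_eq hr, lowSlicePoly_coeff_eq hs]
end

section
/- Let λ ∈ Λ_{n,m}, let c be a good point of λ, and let d satisfy c < d < c^∧ and λ(d) = ∨. Then d is a good point of λ and d^∧ < c^∧; thus the pair (d, d^∧) is strictly nested inside (c, c^∧), i.e. every ∨-point lying strictly inside a matched pair is matched strictly inside that pair. -/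
open scoped Classical

namespace ArcAlgebra

variable {m : ℕ}

/-- `l : Fin m → Bool` is a weight of type `(n, m)`: positions are `0`-based (position
`a : Fin m` corresponds to the 1-based position `a.val + 1`), the value `true` stands for
`∨` and `false` for `∧`, and `l` takes the value `∨` exactly `n` times. -/
def IsWeight (n : ℕ) (l : Fin m → Bool) : Prop :=
  (Finset.univ.filter (fun a => l a = true)).card = n

/-- The number of `∨`'s strictly between `c` and `c'` equals the number of `∧`'s strictly
between `c` and `c'`. -/
def Balanced (l : Fin m → Bool) (c c' : Fin m) : Prop :=
  (Finset.univ.filter (fun x => c < x ∧ x < c' ∧ l x = true)).card =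
    (Finset.univ.filter (fun x => c < x ∧ x < c' ∧ l x = false)).card

/-- `Matches l c c'` says `c` is a good point of `l` with partner `c^∧ = c'`: one has
`l c = ∨`, `c < c'`, `l c' = ∧`, the counts of `∨`'s and `∧`'s strictly between `c` and
`c'` balance, and `c'` is minimal with these properties. -/
def Matches (l : Fin m → Bool) (c c' : Fin m) : Prop :=
  l c = true ∧ c < c' ∧ l c' = false ∧ Balanced l c c' ∧
    ∀ d : Fin m, c < d → l d = false → Balanced l c d → c' ≤ d

/-- `c` is a good point of `l`. -/
def IsGood (l : Fin m → Bool) (c : Fin m) : Prop :=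
  ∃ c', Matches l c c'

/-- `a` is a ray position of `l`: neither a good point of `l` nor the partner `c^∧` of a
good point `c` of `l`. -/
def RayPos (l : Fin m → Bool) (a : Fin m) : Prop :=
  ¬ IsGood l a ∧ ¬ ∃ c, Matches l c a

/-- `η` orients the diagram of `l`: `η(c) ≠ η(c^∧)` for every good point `c` of `l`, and
whenever `a < b` are ray positions of `l` with `η a = ∨`, also `η b = ∨`. -/
def Orients (η l : Fin m → Bool) : Prop :=
  (∀ c c', Matches l c c' → η c ≠ η c') ∧
    ∀ a b, RayPos l a → RayPos l b → a < b → η a = true → η b = true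

/-- The number of good points of `l`. -/
noncomputable def goodCount (l : Fin m → Bool) : ℕ :=
  (Finset.univ.filter (fun c => IsGood l c)).card

/-- The weight `w_l`: it takes the value `∨` exactly at the partners `c^∧` of the good
points `c` of `l` and at the `n − goodCount l` largest ray positions of `l` (a ray position
`a` is among the `k` largest ray positions iff fewer than `k` ray positions exceed it). -/
noncomputable def wMax (n : ℕ) (l : Fin m → Bool) : Fin m → Bool := fun a =>
  if (∃ c, Matches l c a) ∨
      (RayPos l a ∧
        (Finset.univ.filter (fun b => RayPos l b ∧ a < b)).card < n - goodCount l)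
  then true else false

/-- The Bruhat order on weights: `l ≤ μ` iff there is a bijection `f` from `l⁻¹(∨)` to
`μ⁻¹(∨)` with `x ≤ f x` for all `x`. -/
def BruhatLE (l μ : Fin m → Bool) : Prop :=
  ∃ f : {x : Fin m // l x = true} → {y : Fin m // μ y = true},
    Function.Bijective f ∧ ∀ x, x.1 ≤ (f x).1

end ArcAlgebra

open ArcAlgebra

namespace ArcAlgebra

/-- The number of `∨`'s minus the number of `∧`'s among the first `k` positions of `l`. -/
def height {m : ℕ} (l : Fin m → Bool) (k : ℕ) : ℤ :=
  ∑ x : Fin m, if x.val < k then (if l x = true then 1 else -1) else 0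

theorem height_succ {m : ℕ} (l : Fin m → Bool) (c : Fin m) :
    height l (c.val + 1) = height l c.val + if l c = true then 1 else -1 := by
  rw [← sub_eq_iff_eq_add', height, height, ← Finset.sum_sub_distrib,
    Finset.sum_eq_single c]
  · simp
  · intro x _ hx
    have hne : x.val ≠ c.val := fun h => hx (Fin.ext h)
    split_ifs <;> omega
  · simp

theorem balanced_iff_height_eq {m : ℕ} (l : Fin m → Bool) {c c' : Fin m} (h : c < c') :
    Balanced l c c' ↔ height l c'.val = height l (c.val + 1) := by
  have hdiff : height l c'.val - height l (c.val + 1) =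
      ((Finset.univ.filter (fun x => c < x ∧ x < c' ∧ l x = true)).card : ℤ) -
        ((Finset.univ.filter (fun x => c < x ∧ x < c' ∧ l x = false)).card : ℤ) := by
    rw [Finset.card_filter, Finset.card_filter, height, height]
    push_cast
    rw [← Finset.sum_sub_distrib, ← Finset.sum_sub_distrib]
    refine Finset.sum_congr rfl fun x _ => ?_
    simp only [Fin.lt_def] at h ⊢
    cases l x <;> simp only [reduceCtorEq, and_true, and_false, if_true, if_false] <;>
      split_ifs <;> omega
  unfold Balanced
  omega

/-- Strictly between a good point and its partner the height stays above that of the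
good point. -/
theorem Matches.height_lt {m : ℕ} {l : Fin m → Bool} {c e : Fin m} (h : Matches l c e)
    {k : ℕ} (hck : c.val < k) (hke : k ≤ e.val) : height l c.val < height l k := by
  obtain ⟨hc, -, -, -, hmin⟩ := h
  have hc1 := height_succ l c
  rw [if_pos hc] at hc1
  induction k, hck using Nat.le_induction with
  | base => exact hc1 ▸ lt_add_one _
  | succ k hck ih =>
    have hk := ih (by omega)
    let x : Fin m := ⟨k, by omega⟩
    have hx : height l (k + 1) = height l k + if l x = true then 1 else -1 :=
      height_succ l x
    have hcx : c < x := hck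
    by_cases hlx : l x = true
    · rw [if_pos hlx] at hx
      omega
    · rw [if_neg hlx] at hx
      by_contra! hle
      have hex : e ≤ x := hmin x hcx (by simpa using hlx)
        ((balanced_iff_height_eq l hcx).2 (show height l k = _ by omega))
      have : e.val ≤ k := hex
      omega

/-- A `∨`-point `d` is matched before any later position at which the height has
returned to at most that of `d`. -/
theorem exists_matches_of_height_le {m : ℕ} {l : Fin m → Bool} {d : Fin m}
    (hd : l d = true) {j : ℕ} (hdj : d.val < j) (hjm : j ≤ m)
    (hj : height l j ≤ height l d.val) :
    ∃ e, Matches l d e ∧ e.val < j := by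
  have hd1 := height_succ l d
  rw [if_pos hd] at hd1
  have hex : ∃ k, d.val < k ∧ height l (k + 1) ≤ height l d.val := by
    obtain ⟨k, rfl⟩ : ∃ k, j = k + 1 := ⟨j - 1, by omega⟩
    refine ⟨k, lt_of_le_of_ne (by omega) ?_, hj⟩
    rintro rfl
    omega
  obtain ⟨hdk, hk⟩ := Nat.find_spec hex
  have hmin : ∀ i, d.val < i → height l (i + 1) ≤ height l d.val → Nat.find hex ≤ i :=
    fun i h₁ h₂ => Nat.find_min' hex ⟨h₁, h₂⟩
  generalize Nat.find hex = k at hdk hk hmin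
  have hkj : k < j := by
    obtain ⟨i, rfl⟩ : ∃ i, j = i + 1 := ⟨j - 1, by omega⟩
    have hdi : d.val ≠ i := by
      rintro rfl
      omega
    have := hmin i (by omega) hj
    omega
  have hlow : height l d.val < height l k := by
    obtain ⟨i, rfl⟩ : ∃ i, k = i + 1 := ⟨k - 1, by omega⟩
    by_contra! hle
    have hdi : d.val ≠ i := by
      rintro rfl
      omega
    have := hmin i (by omega) hle
    omega
  let x : Fin m := ⟨k, by omega⟩
  have hx : height l (k + 1) = height l k + if l x = true then 1 else -1 :=
    height_succ l x
  have hdx : d < x := hdk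
  have hlx : l x ≠ true := by
    intro hlx
    rw [if_pos hlx] at hx
    omega
  rw [if_neg hlx] at hx
  refine ⟨x, ⟨hd, hdx, by simpa using hlx,
    (balanced_iff_height_eq l hdx).2 (show height l k = _ by omega), ?_⟩, hkj⟩
  intro y hdy hy hbal
  rw [balanced_iff_height_eq l hdy] at hbal
  have hy1 := height_succ l y
  rw [if_neg (by simp [hy])] at hy1
  exact hmin y.val hdy (by omega)

end ArcAlgebra

/-- Let `λ ∈ Λ_{n,m}`, let `c` be a good point of `λ` with partner
`e = c^∧`, and let `d` satisfy `c < d < c^∧` and `λ(d) = ∨`.  Then `d` is a good point of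
`λ` and `d^∧ < c^∧`: every `∨`-point lying strictly inside a matched pair is matched
strictly inside that pair. -/
theorem statement8 (n m : ℕ) (l : Fin m → Bool) (hl : IsWeight n l)
    (c e d : Fin m) (hce : Matches l c e) (hcd : c < d) (hde : d < e)
    (hd : l d = true) :
    ∃ e', Matches l d e' ∧ e' < e := by
  have hlow := hce.height_lt hcd hde.le
  obtain ⟨hc, hlt, -, hbal, -⟩ := hce
  rw [balanced_iff_height_eq l hlt, height_succ, if_pos hc] at hbal
  exact exists_matches_of_height_le hd hde e.isLt.le (by omega)
end
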